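/- arXiv:2209.04191 — 2 statements merged into one kernel-verified Lean document; each statement's English description precedes it below -/
import Mathlib

section
/- Let λ > 0, N ≥ 1, and let z₁,...,z_K ∈ [0,1)×[0,N) be K ≥ N+1 distinct points. Then the sampled STFT with Gaussian window gives a frame for S_N ≅ ℂ^N: there exist A, B > 0 such that for all a ∈ ℂ^N, A‖a‖² ≤ ∑_{k=1}^K |∑_{n=0}^{N-1} a_n e^{-2πiξ_k n/N} Z(h^λ)(n/N - x_k, ξ_k)|² ≤ B‖a‖², where z_k = (x_k, ξ_k) and h^λ(t) = e^{-πλt²}. -/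
open Complex Finset

/-- The Zak transform. -/
noncomputable def zak (h : ℝ → ℂ) (x ξ : ℝ) : ℂ :=
  ∑' k : ℤ, h (x - k) * Complex.exp (2 * Real.pi * Complex.I * k * ξ)

/-- The STFT of `φ = ∑ a_n ε_n ∈ S_N` with real window `h`. -/
noncomputable def stftSN (h : ℝ → ℂ) (N : ℕ) (a : Fin N → ℂ) (x ξ : ℝ) : ℂ :=
  ∑ n : Fin N, a n * Complex.exp (-2 * Real.pi * Complex.I * ξ * (n : ℝ) / N) *
    zak h ((n : ℝ) / N - x) ξ

/-- The infinite product `∏ (1 - qⁿ u)` over `n ≥ 0`. -/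
noncomputable def qProd (q u : ℂ) : ℂ := ∏' n : ℕ, (1 + -(q ^ n * u))

lemma summable_norm_neg_pow_mul {q : ℂ} (hq : ‖q‖ < 1) (u : ℂ) :
    Summable fun n : ℕ => ‖-(q ^ n * u)‖ := by
  simpa using (summable_geometric_of_lt_one (norm_nonneg _) hq).mul_right ‖u‖

lemma qProd_eq_one_sub_mul {q : ℂ} (hq : ‖q‖ < 1) (u : ℂ) :
    qProd q u = (1 - u) * qProd q (q * u) := by
  have hm := multipliable_one_add_of_summable (summable_norm_neg_pow_mul hq (q * u))
  rw [qProd, qProd, tprod_eq_zero_mul' (by simpa only [pow_succ, mul_assoc] using hm)]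
  simp only [pow_succ, mul_assoc, pow_zero, one_mul, sub_eq_add_neg]

lemma qProd_ne_zero {q u : ℂ} (hq : ‖q‖ < 1) (hu : ∀ n : ℕ, q ^ n * u ≠ 1) : qProd q u ≠ 0 :=
  tprod_one_add_ne_zero_of_summable
    (fun n h => hu n (by linear_combination -h)) (summable_norm_neg_pow_mul hq u)

lemma differentiable_qProd {q : ℂ} (hq : ‖q‖ < 1) : Differentiable ℂ (qProd q) := by
  intro u
  have hprod := (((summable_geometric_of_lt_one (norm_nonneg _) hq).mul_right
    (‖u‖ + 1)).hasProdLocallyUniformlyOn_nat_one_add (f := fun n v => -(q ^ n * v))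
    (Metric.isOpen_ball (x := (0 : ℂ)) (ε := ‖u‖ + 1)) (.of_forall fun n v hv => by
      rw [norm_neg, norm_mul, norm_pow]
      have : ‖v‖ ≤ ‖u‖ + 1 := by simpa using (mem_ball_zero_iff.1 hv).le
      gcongr) fun n => by fun_prop)
  refine (hprod.differentiableOn (.of_forall fun _ => ?_) Metric.isOpen_ball).differentiableAt
    (Metric.isOpen_ball.mem_nhds (by simp))
  simpa [Finset.prod_fn] using DifferentiableOn.finsetProd (fun _ _ => by fun_prop)

/-- An entire function with period `2πi/α`, quasi-period `lam`, and exactly the zeros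
`lam ℤ + (2πi/α) ℤ`, all of them simple. -/
noncomputable def thetaProd (α lam : ℝ) (w : ℂ) : ℂ :=
  qProd (exp (-(α * lam))) (exp (α * w)) * qProd (exp (-(α * lam))) (exp (-(α * (lam + w))))

section ThetaProd

variable {α lam : ℝ}

lemma norm_exp_neg_mul_lt_one (hα : 0 < α) (hl : 0 < lam) : ‖exp (-((α : ℂ) * lam))‖ < 1 := by
  rw [norm_exp]
  simpa using mul_pos hα hl

lemma differentiable_thetaProd (hα : 0 < α) (hl : 0 < lam) :
    Differentiable ℂ (thetaProd α lam) := by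
  have h := differentiable_qProd (norm_exp_neg_mul_lt_one hα hl)
  exact (h.comp (by fun_prop)).mul (h.comp (by fun_prop))

lemma exp_mul_add_period (hα : 0 < α) (w : ℂ) :
    exp (α * (w + 2 * Real.pi / α * I)) = exp (α * w) := by
  have : (α : ℂ) ≠ 0 := by exact_mod_cast hα.ne'
  rw [exp_eq_exp_iff_exists_int]
  exact ⟨1, by field_simp; simp⟩

lemma thetaProd_add_period (hα : 0 < α) (w : ℂ) :
    thetaProd α lam (w + 2 * Real.pi / α * I) = thetaProd α lam w := by
  have h := exp_mul_add_period hα w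
  have h' : exp (-(α * (lam + (w + 2 * Real.pi / α * I)))) = exp (-(α * (lam + w))) := by
    rw [mul_add, mul_add (α : ℂ) lam w, neg_add, neg_add, exp_add, exp_add,
      exp_neg (α * (w + _)), h, ← exp_neg]
  rw [thetaProd, h, h', thetaProd]

lemma thetaProd_add (hα : 0 < α) (hl : 0 < lam) (w : ℂ) :
    thetaProd α lam (w + lam) = -exp (α * (w + lam)) * thetaProd α lam w := by
  have hq := norm_exp_neg_mul_lt_one hα hl
  have h₁ := qProd_eq_one_sub_mul hq (exp (α * (w + lam)))
  have h₂ := qProd_eq_one_sub_mul hq (exp (-(α * (lam + w))))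
  rw [← exp_add] at h₁ h₂
  rw [show -(α * lam : ℂ) + α * (w + lam) = α * w by ring] at h₁
  rw [show -(α * lam : ℂ) + -(α * (lam + w)) = -(α * (lam + (w + lam))) by ring] at h₂
  have h₃ : exp (α * (w + lam)) * exp (-(α * (lam + w))) = 1 := by
    rw [← exp_add, add_comm (lam : ℂ), add_neg_cancel, exp_zero]
  rw [thetaProd, thetaProd, h₁, h₂]
  linear_combination (-qProd (exp (-(α * lam))) (exp (α * w)) *
    qProd (exp (-(α * lam))) (exp (-(α * (lam + (w + lam)))))) * h₃

lemma exists_int_of_thetaProd_eq_zero (hα : 0 < α) (hl : 0 < lam) {w : ℂ}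
    (hw : thetaProd α lam w = 0) : ∃ m k : ℤ, w = m * lam + k * (2 * Real.pi / α * I) := by
  have hα' : (α : ℂ) ≠ 0 := by exact_mod_cast hα.ne'
  have hq := norm_exp_neg_mul_lt_one hα hl
  rcases mul_eq_zero.1 hw with h | h
  · have : ∃ n : ℕ, exp (-(α * lam)) ^ n * exp (α * w) = 1 := by
      by_contra! hn
      exact qProd_ne_zero hq hn h
    obtain ⟨n, hn⟩ := this
    rw [← exp_nat_mul, ← exp_add, exp_eq_one_iff] at hn
    obtain ⟨k, hk⟩ := hn
    refine ⟨n, k, mul_left_cancel₀ hα' ?_⟩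
    field_simp
    push_cast
    linear_combination hk
  · have : ∃ n : ℕ, exp (-(α * lam)) ^ n * exp (-(α * (lam + w))) = 1 := by
      by_contra! hn
      exact qProd_ne_zero hq hn h
    obtain ⟨n, hn⟩ := this
    rw [← exp_nat_mul, ← exp_add, exp_eq_one_iff] at hn
    obtain ⟨k, hk⟩ := hn
    refine ⟨-(n + 1), -k, mul_left_cancel₀ hα' ?_⟩
    field_simp
    push_cast
    linear_combination -hk

lemma thetaProd_zero (hα : 0 < α) (hl : 0 < lam) : thetaProd α lam 0 = 0 := by
  rw [thetaProd, qProd_eq_one_sub_mul (norm_exp_neg_mul_lt_one hα hl)]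
  simp

lemma deriv_thetaProd_zero_ne (hα : 0 < α) (hl : 0 < lam) : deriv (thetaProd α lam) 0 ≠ 0 := by
  have hq := norm_exp_neg_mul_lt_one hα hl
  set q := exp (-((α : ℂ) * lam)) with hq_def
  have hd := differentiable_qProd hq
  let v : ℂ → ℂ := fun w => qProd q (q * exp (α * w)) * qProd q (exp (-(α * (lam + w))))
  have hv : Differentiable ℂ v := (hd.comp (by fun_prop)).mul (hd.comp (by fun_prop))
  have hfun : thetaProd α lam = fun w => (1 - exp (α * w)) * v w := by
    funext w
    rw [thetaProd, qProd_eq_one_sub_mul hq, mul_assoc]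
  have hu : HasDerivAt (fun w : ℂ => 1 - exp (α * w)) (-α) 0 := by
    simpa using (((hasDerivAt_id (0 : ℂ)).const_mul (α : ℂ)).cexp).const_sub 1
  have hv0 : v 0 ≠ 0 := by
    have hA : qProd q q ≠ 0 := qProd_ne_zero hq fun n hn => by
      have := congrArg norm hn
      rw [← pow_succ, norm_pow, norm_one] at this
      exact (pow_lt_one₀ (norm_nonneg _) hq n.succ_ne_zero).ne this
    simpa [v, ← hq_def] using hA
  rw [hfun, (hu.fun_mul (hv 0).hasDerivAt).deriv]
  simpa using ⟨hα.ne', hv0⟩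

lemma deriv_thetaProd_add_period (hα : 0 < α) (w : ℂ) :
    deriv (thetaProd α lam) (w + 2 * Real.pi / α * I) = deriv (thetaProd α lam) w := by
  rw [← deriv_comp_add_const]
  exact congrArg (deriv · w) (funext (thetaProd_add_period hα))

lemma deriv_thetaProd_add (hα : 0 < α) (hl : 0 < lam) {w : ℂ} (hw : thetaProd α lam w = 0) :
    deriv (thetaProd α lam) (w + lam) =
      -exp (α * (w + lam)) * deriv (thetaProd α lam) w := by
  rw [← deriv_comp_add_const, funext (thetaProd_add hα hl),
    deriv_fun_mul (by fun_prop) (differentiable_thetaProd hα hl w), hw, mul_zero, zero_add]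

lemma deriv_thetaProd_ne_zero (hα : 0 < α) (hl : 0 < lam) {w : ℂ}
    (hw : thetaProd α lam w = 0) : deriv (thetaProd α lam) w ≠ 0 := by
  obtain ⟨m, k, rfl⟩ := exists_int_of_thetaProd_eq_zero hα hl hw
  clear hw
  have hper : Function.Periodic (deriv (thetaProd α lam)) (2 * Real.pi / α * I) :=
    deriv_thetaProd_add_period hα
  rw [hper.int_mul k]
  have key : ∀ z : ℂ, (thetaProd α lam z = 0 ∧ deriv (thetaProd α lam) z ≠ 0) ↔
      (thetaProd α lam (z + lam) = 0 ∧ deriv (thetaProd α lam) (z + lam) ≠ 0) := fun z => by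
    have h : thetaProd α lam (z + lam) = 0 ↔ thetaProd α lam z = 0 := by
      simp [thetaProd_add hα hl]
    rw [h]
    refine and_congr_right fun hz => ?_
    simp [deriv_thetaProd_add hα hl hz]
  suffices h : thetaProd α lam (m * lam) = 0 ∧ deriv (thetaProd α lam) (m * lam) ≠ 0 from h.2
  induction m using Int.induction_on with
  | zero => simpa using ⟨thetaProd_zero hα hl, deriv_thetaProd_zero_ne hα hl⟩
  | succ n ih => simpa [add_mul] using (key _).1 ih
  | pred n ih => exact (key _).2 (by simpa [sub_mul] using ih)

end ThetaProd

section SimpleZeros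

variable {G : ℂ → ℂ}

lemma exists_differentiable_mul_eq {F : ℂ → ℂ} (hF : Differentiable ℂ F)
    (hG : Differentiable ℂ G) (hsimple : ∀ z, G z = 0 → deriv G z ≠ 0)
    (hzero : ∀ z, G z = 0 → F z = 0) :
    ∃ g : ℂ → ℂ, Differentiable ℂ g ∧ ∀ z, F z = G z * g z := by
  classical
  refine ⟨fun z => if G z = 0 then deriv F z / deriv G z else F z / G z, fun z => ?_, fun z => ?_⟩
  · by_cases hz : G z = 0
    · have hdslope : ∀ {H : ℂ → ℂ}, Differentiable ℂ H → Differentiable ℂ (dslope H z) :=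
        fun h => differentiableOn_univ.1
          ((differentiableOn_dslope Filter.univ_mem).2 h.differentiableOn)
      have hne : dslope G z z ≠ 0 := by simpa using hsimple z hz
      refine ((hdslope hF z).div (hdslope hG z) hne).congr_of_eventuallyEq ?_
      filter_upwards [(hdslope hG z).continuousAt.eventually_ne hne] with w hw
      rcases eq_or_ne w z with rfl | hwz
      · simp [hz]
      · have hsub := sub_ne_zero.2 hwz
        have hGw : G w = (w - z) * dslope G z w := by
          simpa [hz] using (sub_smul_dslope G z w).symm
        have hFw : F w = (w - z) * dslope F z w := by
          simpa [hzero z hz] using (sub_smul_dslope F z w).symm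
        have : G w ≠ 0 := hGw ▸ mul_ne_zero hsub hw
        simp only [if_neg this, Pi.div_apply]
        rw [hGw, hFw, mul_div_mul_left _ _ hsub]
    · refine ((hF z).div (hG z) hz).congr_of_eventuallyEq ?_
      filter_upwards [(hG z).continuousAt.eventually_ne hz] with w hw
      simp [hw]
  · by_cases hz : G z = 0
    · simp [hz, hzero z hz]
    · simp [hz, mul_div_cancel₀]

lemma eq_of_mul_eq_mul_of_simple_zeros {φ ψ : ℂ → ℂ} (hφ : Continuous φ) (hψ : Continuous ψ)
    (hG : Differentiable ℂ G) (hsimple : ∀ z, G z = 0 → deriv G z ≠ 0)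
    (h : ∀ z, G z * φ z = G z * ψ z) : φ = ψ := by
  have hdense : Dense {z | G z ≠ 0} := fun z => by
    by_cases hz : G z = 0
    · rw [mem_closure_iff_frequently]
      have := (hG z).hasDerivAt.eventually_ne (c := 0) (hsimple z hz)
      exact (this.frequently).filter_mono nhdsWithin_le_nhds
    · exact subset_closure hz
  exact hφ.ext_on hdense hψ fun z hz => mul_left_cancel₀ hz (h z)

end SimpleZeros

lemma exists_forall_le_of_periodic {u : ℂ → ℝ} (hu : Continuous u) {a b : ℝ} (ha : 0 < a)
    (hb : 0 < b) (hua : Function.Periodic u a) (hub : Function.Periodic u (b * I)) :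
    ∃ M, ∀ w, u w ≤ M := by
  obtain ⟨M, hM⟩ := ((isCompact_Icc (a := (0 : ℝ)) (b := a)).reProdIm
    (isCompact_Icc (a := (0 : ℝ)) (b := b))).bddAbove_image hu.continuousOn
  refine ⟨M, fun w => ?_⟩
  have key : u (w - ⌊w.re / a⌋ * a - ⌊w.im / b⌋ * (b * I)) = u w := by
    rw [hub.sub_int_mul_eq, hua.sub_int_mul_eq]
  rw [← key]
  have hre := Int.floor_le (w.re / a)
  have hre' := Int.lt_floor_add_one (w.re / a)
  have him := Int.floor_le (w.im / b)
  have him' := Int.lt_floor_add_one (w.im / b)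
  rw [le_div_iff₀ ha] at hre
  rw [div_lt_iff₀ ha] at hre'
  rw [le_div_iff₀ hb] at him
  rw [div_lt_iff₀ hb] at him'
  refine hM ⟨_, ?_, rfl⟩
  rw [mem_reProdIm]
  simp only [sub_re, mul_re, intCast_re, ofReal_re, intCast_im, ofReal_im, sub_im, mul_im, I_re,
    I_im, Set.mem_Icc]
  refine ⟨⟨?_, ?_⟩, ?_, ?_⟩ <;> linarith

section QuasiPeriodic

variable {α lam : ℝ} {F : ℂ → ℂ} {C : ℂ}

lemma eq_zero_of_quasiPeriodic_neg (hα : 0 < α) (hl : 0 < lam) (hF : Differentiable ℂ F)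
    (hper : ∀ w, F (w + 2 * Real.pi / α * I) = F w)
    (hquasi : ∀ w, F (w + lam) = C * exp (-(α * w)) * F w) : F = 0 := by
  rcases eq_or_ne C 0 with rfl | hC
  · funext w
    simpa using hquasi (w - lam)
  have hC' : 0 < ‖C‖ := norm_pos_iff.2 hC
  let c : ℝ := -(Real.log ‖C‖ / lam + α / 2)
  let g : ℝ → ℝ := fun s => α * s ^ 2 / (2 * lam) + c * s
  have hg : Continuous g := by fun_prop
  obtain ⟨M, hM⟩ := exists_forall_le_of_periodic (u := fun w => ‖F w‖ * Real.exp (g w.re))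
    (a := lam) (b := 2 * Real.pi / α) (hF.continuous.norm.mul
      (Real.continuous_exp.comp (hg.comp continuous_re))) hl (by positivity)
    (fun w => by
      have hexp : ‖exp (-(α * w))‖ = Real.exp (-(α * w.re)) := by simp [norm_exp]
      have : g (w + lam).re = g w.re + α * w.re - Real.log ‖C‖ := by
        simp only [g, c, add_re, ofReal_re]
        field_simp
        ring
      simp only [this, hquasi, norm_mul, hexp]
      rw [Real.exp_sub, Real.exp_add, Real.exp_neg, Real.exp_log hC']
      field_simp)
    (fun w => by
      have := hper w
      push_cast
      simp [this, g])
  have hbound : ∃ m, ∀ s, m ≤ g s := by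
    refine ⟨-(c ^ 2 * lam / (2 * α)), fun s => ?_⟩
    have : g s + c ^ 2 * lam / (2 * α) = (α * s + c * lam) ^ 2 / (2 * α * lam) := by
      simp only [g]
      field_simp
      ring
    have : 0 ≤ (α * s + c * lam) ^ 2 / (2 * α * lam) := by positivity
    linarith
  obtain ⟨m, hm⟩ := hbound
  have hconst : ∀ w z, F w = F z := hF.apply_eq_apply_of_bounded <| by
    refine isBounded_iff_forall_norm_le.2 ⟨M / Real.exp m, ?_⟩
    rintro _ ⟨w, rfl⟩
    rw [le_div_iff₀ (Real.exp_pos m)]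
    exact le_trans (by gcongr; exact hm w.re) (hM w)
  have h0 : F 0 = C * F 0 := by
    simpa [hconst lam 0] using hquasi 0
  have h1 : F 0 = C * exp (-α) * F 0 := by
    have := hquasi 1
    rwa [hconst (1 + lam) 0, hconst 1 0, mul_one] at this
  have hne : (1 : ℂ) - exp (-α) ≠ 0 := by
    rw [sub_ne_zero]
    exact_mod_cast (Real.exp_lt_one_iff.2 (neg_lt_zero.2 hα)).ne'
  have : F 0 = 0 := by
    refine (mul_eq_zero.1 ?_).resolve_left hne
    linear_combination h1 - exp (-α) * h0
  funext w
  rw [hconst w 0, this, Pi.zero_apply]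

/-- A theta function of degree `n - 1` with at least `n` zeros on the torus vanishes. -/
theorem eq_zero_of_quasiPeriodic_of_zeros (hα : 0 < α) (hl : 0 < lam) {ι : Type*} {p : ι → ℂ}
    {S : Finset ι} {n : ℕ} (hn : n ≤ #S)
    (hp : ∀ i ∈ S, ∀ j ∈ S, i ≠ j → thetaProd α lam (p i - p j) ≠ 0)
    (hF : Differentiable ℂ F) (hper : ∀ w, F (w + 2 * Real.pi / α * I) = F w)
    (hquasi : ∀ w, F (w + lam) = C * exp (α * (n - 1) * w) * F w)
    (hzero : ∀ i ∈ S, F (p i) = 0) : F = 0 := by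
  classical
  induction n generalizing S F C with
  | zero =>
    refine eq_zero_of_quasiPeriodic_neg (C := C) hα hl hF hper fun w => ?_
    rw [hquasi]
    congr 3
    push_cast
    ring
  | succ n ih =>
    obtain ⟨i, hi⟩ := Finset.card_pos.1 (by omega : 0 < #S)
    let G : ℂ → ℂ := fun w => thetaProd α lam (w - p i)
    have hG : Differentiable ℂ G := (differentiable_thetaProd hα hl).comp (by fun_prop)
    have hsimple : ∀ z, G z = 0 → deriv G z ≠ 0 := fun z hz => by
      rw [deriv_comp_sub_const]
      exact deriv_thetaProd_ne_zero hα hl hz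
    have hGper : ∀ w, G (w + 2 * Real.pi / α * I) = G w := fun w => by
      simp only [G]
      rw [add_sub_right_comm, thetaProd_add_period hα]
    have hGquasi : ∀ w, G (w + lam) = -exp (α * (w - p i + lam)) * G w := fun w => by
      simp only [G]
      rw [add_sub_right_comm, thetaProd_add hα hl]
    have hFG : ∀ z, G z = 0 → F z = 0 := fun z hz => by
      obtain ⟨m, k, hmk⟩ := exists_int_of_thetaProd_eq_zero hα hl hz
      have hshift : ∀ w, F (w + lam) = 0 ↔ F w = 0 := fun w => by
        rcases eq_or_ne C 0 with rfl | hC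
        · have h := hquasi (w - lam)
          rw [sub_add_cancel] at h
          simp [hquasi w, h]
        · simp [hquasi w, hC]
      have hiter : Function.Periodic (fun w => F w = 0) (lam : ℂ) :=
        fun w => propext (hshift w)
      have hper' : Function.Periodic F (2 * Real.pi / α * I) := hper
      have hz' : z - k * (2 * Real.pi / α * I) - m * lam = p i := by linear_combination hmk
      rw [← hper'.sub_int_mul_eq k]
      refine (hiter.sub_int_mul_eq m).mp ?_
      rw [hz']
      exact hzero i hi
    obtain ⟨g, hg, hFg⟩ := exists_differentiable_mul_eq hF hG hsimple hFG
    have hgper : (fun w => g (w + 2 * Real.pi / α * I)) = g := by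
      refine eq_of_mul_eq_mul_of_simple_zeros (hg.continuous.comp (by fun_prop)) hg.continuous
        hG hsimple fun z => ?_
      rw [← hFg, ← hper, hFg, hGper]
    have hgquasi : (fun w => g (w + lam)) =
        fun w => -C * exp (α * (p i - lam)) * exp (α * (n - 1) * w) * g w := by
      refine eq_of_mul_eq_mul_of_simple_zeros (hg.continuous.comp (by fun_prop))
        (by have := hg.continuous; fun_prop) hG hsimple fun z => ?_
      have h := hquasi z
      rw [hFg, hFg, hGquasi] at h
      have he : exp (α * ((n + 1 : ℕ) - 1) * z) =
          exp (α * (z - p i + lam)) * (exp (α * (p i - lam)) * exp (α * (n - 1) * z)) := by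
        rw [← exp_add, ← exp_add]
        congr 1
        push_cast
        ring
      rw [he] at h
      refine mul_left_cancel₀ (exp_ne_zero (α * (z - p i + lam))) ?_
      linear_combination -h
    have hg0 : g = 0 := by
      refine ih (S := S.erase i) (by rw [Finset.card_erase_of_mem hi]; omega)
        (fun j hj k hk => hp j (Finset.mem_of_mem_erase hj) k (Finset.mem_of_mem_erase hk))
        hg (congrFun hgper) (congrFun hgquasi) fun j hj => ?_
      have h := hFg (p j)
      rw [hzero j (Finset.mem_of_mem_erase hj)] at h
      exact (mul_eq_zero.1 h.symm).resolve_left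
        (hp j (Finset.mem_of_mem_erase hj) i hi (Finset.ne_of_mem_erase hj))
    funext w
    rw [hFg, hg0]
    simp

end QuasiPeriodic

section GaussianSTFT

variable {lam : ℝ} {N : ℕ}

/-- The entire function which, up to a nonvanishing factor, is the STFT of an element of `S_N`
with Gaussian window. -/
noncomputable def gaussianTheta (lam : ℝ) (N : ℕ) (a : Fin N → ℂ) (w : ℂ) : ℂ :=
  ∑ n : Fin N, a n * exp (-Real.pi * lam * (n / N) ^ 2) * exp (2 * Real.pi / N * n * w) *
    jacobiTheta₂ (I * w - I * lam * (n / N)) (I * lam)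

lemma zak_gaussian (x ξ : ℝ) :
    zak (fun t => (Real.exp (-Real.pi * lam * t ^ 2) : ℂ)) x ξ =
      exp (-Real.pi * lam * x ^ 2) * jacobiTheta₂ (ξ - I * lam * x) (I * lam) := by
  rw [zak, jacobiTheta₂, ← tsum_mul_left]
  refine tsum_congr fun k => ?_
  rw [jacobiTheta₂_term, ofReal_exp, ← exp_add, ← exp_add]
  congr 1
  push_cast
  linear_combination (2 * Real.pi * k * lam * x - Real.pi * k ^ 2 * lam) * I_sq

lemma stftSN_gaussian (a : Fin N → ℂ) (x ξ : ℝ) :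
    stftSN (fun t => (Real.exp (-Real.pi * lam * t ^ 2) : ℂ)) N a x ξ =
      exp (-Real.pi * lam * x ^ 2) * gaussianTheta lam N a (lam * x - I * ξ) := by
  rw [stftSN, gaussianTheta, Finset.mul_sum]
  refine Finset.sum_congr rfl fun n _ => ?_
  rw [zak_gaussian]
  have h : (ξ : ℂ) - I * lam * ((n / N - x : ℝ) : ℂ) =
      I * (lam * x - I * ξ) - I * lam * (n / N) := by
    push_cast
    linear_combination ξ * I_sq
  have he : exp (-2 * Real.pi * I * ξ * ((n : ℝ) : ℂ) / N) *
      exp (-Real.pi * lam * ((n / N - x : ℝ) : ℂ) ^ 2) =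
      exp (-Real.pi * lam * x ^ 2) * (exp (-Real.pi * lam * (n / N) ^ 2) *
        exp (2 * Real.pi / N * n * (lam * x - I * ξ))) := by
    simp only [← exp_add]
    congr 1
    push_cast
    ring
  rw [h]
  linear_combination (a n * jacobiTheta₂ (I * (lam * x - I * ξ) - I * lam * (n / N)) (I * lam)) * he

lemma im_I_mul_pos (hl : 0 < lam) : 0 < (I * lam : ℂ).im := by simpa

lemma differentiable_gaussianTheta (hl : 0 < lam) (a : Fin N → ℂ) :
    Differentiable ℂ (gaussianTheta lam N a) := by
  have hθ : Differentiable ℂ fun z => jacobiTheta₂ z (I * lam) :=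
    fun z => differentiableAt_jacobiTheta₂_fst z (im_I_mul_pos hl)
  refine Differentiable.fun_sum fun n _ => .mul (by fun_prop) (hθ.comp (by fun_prop))

lemma gaussianTheta_add_nat_mul_I (a : Fin N → ℂ) (w : ℂ) (j : ℕ) :
    gaussianTheta lam N a (w + j * I) =
      ∑ n : Fin N, (exp (2 * Real.pi * I / N) ^ j) ^ (n : ℕ) *
        (a n * exp (-Real.pi * lam * (n / N) ^ 2) * exp (2 * Real.pi / N * n * w) *
          jacobiTheta₂ (I * w - I * lam * (n / N)) (I * lam)) := by
  have hper : Function.Periodic (fun z => jacobiTheta₂ z (I * lam)) 1 :=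
    fun z => jacobiTheta₂_add_left z _
  refine Finset.sum_congr rfl fun n _ => ?_
  have hθ := hper.sub_nat_mul_eq (x := I * w - I * lam * (n / N)) j
  have harg : I * (w + j * I) - I * lam * (n / N) = I * w - I * lam * (n / N) - j * 1 := by
    linear_combination j * I_sq
  have he : exp (2 * Real.pi / N * n * (w + j * I)) =
      (exp (2 * Real.pi * I / N) ^ j) ^ (n : ℕ) * exp (2 * Real.pi / N * n * w) := by
    rw [← exp_nat_mul, ← exp_nat_mul, ← exp_add]
    congr 1
    ring
  rw [harg, hθ, he]
  ring

lemma gaussianTheta_add_N_mul_I (hN : 1 ≤ N) (a : Fin N → ℂ) (w : ℂ) :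
    gaussianTheta lam N a (w + N * I) = gaussianTheta lam N a w := by
  rw [gaussianTheta_add_nat_mul_I,
    (isPrimitiveRoot_exp N (by omega)).pow_eq_one, gaussianTheta]
  simp

lemma gaussianTheta_add (hN : 1 ≤ N) (a : Fin N → ℂ) (w : ℂ) :
    gaussianTheta lam N a (w + lam) =
      exp (Real.pi * lam) * exp (2 * Real.pi * w) * gaussianTheta lam N a w := by
  have hN' : (N : ℂ) ≠ 0 := by exact_mod_cast (by omega : N ≠ 0)
  rw [gaussianTheta, gaussianTheta, Finset.mul_sum]
  refine Finset.sum_congr rfl fun n _ => ?_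
  have harg : I * (w + lam) - I * lam * (n / N) = I * w - I * lam * (n / N) + I * lam := by ring
  have he : exp (2 * Real.pi / N * n * (w + lam)) *
      exp (-Real.pi * I * (I * lam + 2 * (I * w - I * lam * (n / N)))) =
      exp (Real.pi * lam) * exp (2 * Real.pi * w) * exp (2 * Real.pi / N * n * w) := by
    simp only [← exp_add]
    congr 1
    linear_combination
      (-Real.pi * (lam + 2 * w - 2 * lam * (n / N))) * I_sq
  rw [harg, jacobiTheta₂_add_left']
  linear_combination (a n * exp (-Real.pi * lam * (n / N) ^ 2) *
    jacobiTheta₂ (I * w - I * lam * (n / N)) (I * lam)) * he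

lemma jacobiTheta₂_zero_ne_zero (hl : 0 < lam) : jacobiTheta₂ 0 (I * lam) ≠ 0 := by
  have hterm : ∀ n : ℤ, jacobiTheta₂_term n 0 (I * lam) =
      (Real.exp (-Real.pi * n ^ 2 * lam) : ℂ) := fun n => by
    rw [jacobiTheta₂_term, ofReal_exp]
    congr 1
    push_cast
    linear_combination (Real.pi * n ^ 2 * lam) * I_sq
  have hs := (hasSum_jacobiTheta₂_term 0 (im_I_mul_pos hl)).summable
  simp only [hterm] at hs
  rw [jacobiTheta₂, tsum_congr hterm, ← ofReal_tsum]
  exact_mod_cast ((summable_ofReal.1 hs).tsum_pos (fun _ => (Real.exp_pos _).le) 0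
    (Real.exp_pos _)).ne'

lemma eq_zero_of_gaussianTheta_eq_zero (hl : 0 < lam) (hN : 1 ≤ N) {a : Fin N → ℂ}
    (h : gaussianTheta lam N a = 0) : a = 0 := by
  funext n
  let v : Fin N → ℂ := fun m => a m * exp (-Real.pi * lam * (m / N) ^ 2) *
    exp (2 * Real.pi / N * m * (lam * (n / N))) *
    jacobiTheta₂ (I * (lam * (n / N)) - I * lam * (m / N)) (I * lam)
  have hv : v = 0 := by
    refine Matrix.eq_zero_of_forall_index_sum_pow_mul_eq_zero
      (f := fun j : Fin N => exp (2 * Real.pi * I / N) ^ (j : ℕ)) (fun i j hij => ?_) fun j => ?_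
    · exact Fin.ext ((isPrimitiveRoot_exp N (by omega)).pow_inj i.2 j.2 hij)
    · rw [← gaussianTheta_add_nat_mul_I, h, Pi.zero_apply]
  have hvn := congrFun hv n
  simp only [v, Pi.zero_apply, mul_eq_zero, exp_ne_zero, or_false] at hvn
  refine hvn.resolve_right ?_
  rw [← mul_assoc, sub_self]
  exact jacobiTheta₂_zero_ne_zero hl

theorem eq_zero_of_stftSN_gaussian_eq_zero (hl : 0 < lam) (hN : 1 ≤ N) {K : ℕ} (hK : N + 1 ≤ K)
    {z : Fin K → ℝ × ℝ} (hz_inj : Function.Injective z)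
    (hz_mem : ∀ k, 0 ≤ (z k).1 ∧ (z k).1 < 1 ∧ 0 ≤ (z k).2 ∧ (z k).2 < N) {a : Fin N → ℂ}
    (ha : ∀ k, stftSN (fun t => (Real.exp (-Real.pi * lam * t ^ 2) : ℂ)) N a
      (z k).1 (z k).2 = 0) : a = 0 := by
  have hN0 : (0 : ℝ) < N := by exact_mod_cast hN
  have hNC : (N : ℂ) ≠ 0 := by exact_mod_cast hN0.ne'
  have hpi : (Real.pi : ℂ) ≠ 0 := by exact_mod_cast Real.pi_ne_zero
  have hα : 0 < 2 * Real.pi / N := by positivity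
  have hperiod : 2 * (Real.pi : ℂ) / ((2 * Real.pi / N : ℝ) : ℂ) = N := by
    push_cast
    field_simp
  refine eq_zero_of_gaussianTheta_eq_zero hl hN ?_
  refine eq_zero_of_quasiPeriodic_of_zeros hα hl (S := Finset.univ) (n := N + 1)
    (p := fun k => lam * (z k).1 - I * (z k).2) (C := exp (Real.pi * lam)) (by simpa)
    (fun i _ j _ hij h => hij (hz_inj ?_)) (differentiable_gaussianTheta hl a)
    (fun w => by rw [hperiod, gaussianTheta_add_N_mul_I hN]) (fun w => ?_) fun k _ => ?_
  · obtain ⟨m, k, hmk⟩ := exists_int_of_thetaProd_eq_zero hα hl h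
    rw [hperiod] at hmk
    have hre : lam * (z i).1 - lam * (z j).1 = m * lam := by
      simpa using congrArg re hmk
    have him : (z j).2 - (z i).2 = k * N := by
      have : -(z i).2 + (z j).2 = k * N := by simpa using congrArg im hmk
      linarith
    obtain ⟨hi1, hi2, hi3, hi4⟩ := hz_mem i
    obtain ⟨hj1, hj2, hj3, hj4⟩ := hz_mem j
    have hre' : (z i).1 - (z j).1 = m := by
      apply mul_left_cancel₀ hl.ne'
      linear_combination hre
    have hm : m = 0 := by
      rw [← Int.abs_lt_one_iff, ← Int.cast_lt (R := ℝ), Int.cast_abs, ← hre', Int.cast_one,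
        abs_lt]
      constructor <;> linarith
    have hk : k = 0 := by
      rw [← Int.abs_lt_one_iff, ← Int.cast_lt (R := ℝ), Int.cast_abs, Int.cast_one]
      have : |(k : ℝ) * N| < 1 * N := by
        rw [← him, abs_lt]
        constructor <;> linarith
      rw [abs_mul, abs_of_pos hN0] at this
      exact lt_of_mul_lt_mul_right this hN0.le
    simp only [hm, hk, Int.cast_zero, zero_mul] at hre' him
    exact Prod.ext (by linarith) (by linarith)
  · rw [gaussianTheta_add hN]
    congr 3
    push_cast
    field_simp
    ring
  · have h := ha k
    rw [stftSN_gaussian] at h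
    exact (mul_eq_zero.1 h).resolve_left (exp_ne_zero _)

end GaussianSTFT

/-- An injective linear map between finite-dimensional coordinate spaces satisfies
frame inequalities. -/
lemma exists_frame_bounds_of_injective {ι κ : Type*} [Fintype ι] [Fintype κ]
    (T : (ι → ℂ) →ₗ[ℂ] (κ → ℂ)) (hT : Function.Injective T) :
    ∃ A B : ℝ, 0 < A ∧ 0 < B ∧ ∀ a : ι → ℂ, A * ∑ i, ‖a i‖ ^ 2 ≤ ∑ k, ‖T a k‖ ^ 2 ∧
      ∑ k, ‖T a k‖ ^ 2 ≤ B * ∑ i, ‖a i‖ ^ 2 := by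
  let e := WithLp.linearEquiv 2 ℂ (ι → ℂ)
  let e' := WithLp.linearEquiv 2 ℂ (κ → ℂ)
  let U : EuclideanSpace ℂ ι →ₗ[ℂ] EuclideanSpace ℂ κ := e'.symm.toLinearMap ∘ₗ T ∘ₗ e.toLinearMap
  have hU : LinearMap.ker U = ⊥ := LinearMap.ker_eq_bot.2
    (e'.symm.injective.comp (hT.comp e.injective))
  obtain ⟨c, hc, hlow⟩ := U.exists_antilipschitzWith hU
  let V := U.toContinuousLinearMap
  have hin : ∀ a : ι → ℂ, ∑ i, ‖a i‖ ^ 2 = ‖WithLp.toLp 2 a‖ ^ 2 := fun a => by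
    rw [EuclideanSpace.norm_sq_eq]
  have hout : ∀ a : ι → ℂ, ∑ k, ‖T a k‖ ^ 2 = ‖V (WithLp.toLp 2 a)‖ ^ 2 := fun a => by
    rw [EuclideanSpace.norm_sq_eq]
    rfl
  have hc' : (0 : ℝ) < c := hc
  refine ⟨1 / (c : ℝ) ^ 2, ‖V‖ ^ 2 + 1, by positivity, by positivity, fun a => ?_⟩
  rw [hin, hout]
  constructor
  · rw [one_div, inv_mul_le_iff₀ (by positivity), ← mul_pow]
    gcongr
    simpa [V] using hlow.le_mul_norm_sub (WithLp.toLp 2 a) 0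
  · calc ‖V (WithLp.toLp 2 a)‖ ^ 2 ≤ (‖V‖ * ‖WithLp.toLp 2 a‖) ^ 2 := by
          gcongr
          exact V.le_opNorm _
      _ ≤ (‖V‖ ^ 2 + 1) * ‖WithLp.toLp 2 a‖ ^ 2 := by
          rw [mul_pow]
          gcongr
          linarith

/-- Sampling `stftSN h N` at finitely many points, as a linear map. -/
noncomputable def stftSNSampling (h : ℝ → ℂ) (N : ℕ) {K : ℕ} (z : Fin K → ℝ × ℝ) :
    (Fin N → ℂ) →ₗ[ℂ] (Fin K → ℂ) where
  toFun a k := stftSN h N a (z k).1 (z k).2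
  map_add' a b := by
    funext k
    simp only [stftSN, Pi.add_apply, add_mul, Finset.sum_add_distrib]
  map_smul' c a := by
    funext k
    simp only [stftSN, Pi.smul_apply, smul_eq_mul, RingHom.id_apply, Finset.mul_sum, mul_assoc]

theorem gaussian_sampling_frame_flat_torus (lam : ℝ) (hlam : 0 < lam)
    (N K : ℕ) (hN : 1 ≤ N) (hK : N + 1 ≤ K)
    (z : Fin K → ℝ × ℝ) (hz_inj : Function.Injective z)
    (hz_mem : ∀ k, 0 ≤ (z k).1 ∧ (z k).1 < 1 ∧ 0 ≤ (z k).2 ∧ (z k).2 < N) :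
    ∃ A B : ℝ, 0 < A ∧ 0 < B ∧ ∀ a : Fin N → ℂ,
      A * ∑ n : Fin N, ‖a n‖ ^ 2 ≤
        (∑ k : Fin K,
          ‖stftSN (fun t => (Real.exp (-Real.pi * lam * t ^ 2) : ℂ)) N a
            (z k).1 (z k).2‖ ^ 2) ∧
      (∑ k : Fin K,
          ‖stftSN (fun t => (Real.exp (-Real.pi * lam * t ^ 2) : ℂ)) N a
            (z k).1 (z k).2‖ ^ 2) ≤ B * ∑ n : Fin N, ‖a n‖ ^ 2 := by
  refine exists_frame_bounds_of_injective (stftSNSampling _ N z)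
    ((injective_iff_map_eq_zero _).2 fun a ha => ?_)
  exact eq_zero_of_stftSN_gaussian_eq_zero hlam hN hK hz_inj hz_mem (congrFun ha)
end

section
/- Let N ≥ 2 be even, λ > 0, and let (j₁,l₁),...,(j_N,l_N) be distinct pairs with j_k, l_k ∈ {0,...,N-1}. The set {π(j_k,l_k) h_N^λ}_{k=1}^N is a basis of ℂ^N (equivalently, a frame) if and only if ∑_{k=1}^N (j_k, l_k) ∉ Nℕ × Nℕ, i.e., it is not the case that N divides both ∑_k j_k and ∑_k l_k. -/
open Complex Finset

/-- The time-frequency shift `π(k,l)` on `ℂ^N ≅ (ZMod N → ℂ)`. -/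
noncomputable def tfShift {N : ℕ} [NeZero N] (k l : ZMod N) (g : ZMod N → ℂ) :
    ZMod N → ℂ :=
  fun m => Complex.exp (2 * Real.pi * Complex.I * (l.val : ℂ) * (m.val : ℂ) / N) * g (m - k)

/-- The periodized and sampled dilated Gaussian window in `ℂ^N`. -/
noncomputable def periodizedGaussian (N : ℕ) [NeZero N] (lam : ℝ) : ZMod N → ℂ :=
  fun m => ((∑' j : ℤ, Real.exp (-Real.pi * lam * ((m.val : ℝ) / N - j) ^ 2) : ℝ) : ℂ)

theorem laurent_mul {a b : ℤ → ℂ} {x : ℂ} (hx : x ≠ 0)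
    (ha : Summable fun m => ‖a m * x ^ m‖) (hb : Summable fun m => ‖b m * x ^ m‖) :
    (∀ m, Summable fun n => a n * b (m - n)) ∧
    (Summable fun m => ‖(∑' n, a n * b (m - n)) * x ^ m‖) ∧
    HasSum (fun m => (∑' n, a n * b (m - n)) * x ^ m)
      ((∑' m, a m * x ^ m) * ∑' m, b m * x ^ m) := by
  let e : ℤ × ℤ ≃ ℤ × ℤ :=
    { toFun := fun p => (p.2, p.1 - p.2)
      invFun := fun p => (p.1 + p.2, p.1)
      left_inv := fun p => by ext <;> simp
      right_inv := fun p => by ext <;> simp }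
  have hterm : ∀ m n : ℤ, (a n * x ^ n) * (b (m - n) * x ^ (m - n)) =
      a n * b (m - n) * x ^ m := by
    intro m n
    rw [zpow_sub₀ hx]
    have := zpow_ne_zero n hx
    field_simp
  have hs : Summable fun p : ℤ × ℤ => ‖(a p.2 * b (p.1 - p.2)) * x ^ p.1‖ := by
    have := (e.summable_iff).2 (ha.mul_norm hb)
    refine this.congr fun p => ?_
    simp only [Function.comp_apply, e, Equiv.coe_fn_mk, hterm]
  have hS : HasSum (fun p : ℤ × ℤ => (a p.2 * b (p.1 - p.2)) * x ^ p.1)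
      ((∑' m, a m * x ^ m) * ∑' m, b m * x ^ m) := by
    have h1 := (summable_mul_of_summable_norm ha hb).hasSum
    rw [← tsum_mul_tsum_of_summable_norm ha hb] at h1
    have h2 : (fun p : ℤ × ℤ => (a p.2 * b (p.1 - p.2)) * x ^ p.1) =
        (fun p : ℤ × ℤ => (a p.1 * x ^ p.1) * (b p.2 * x ^ p.2)) ∘ e :=
      funext fun p => (hterm p.1 p.2).symm
    rw [h2]
    exact (e.hasSum_iff).2 h1
  have hrow : ∀ m, Summable fun n => a n * b (m - n) := by
    intro m
    have h : Summable fun n => a n * b (m - n) * x ^ m := hs.of_norm.prod_factor m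
    exact (summable_mul_right_iff (zpow_ne_zero m hx)).1 h
  refine ⟨hrow, ?_, ?_⟩
  · refine Summable.of_nonneg_of_le (fun _ => norm_nonneg _) (fun m => ?_) hs.prod
    rw [← tsum_mul_right]
    exact norm_tsum_le_tsum_norm (hs.prod_factor m)
  · have h : ∀ m, HasSum (fun n => a n * b (m - n) * x ^ m)
        ((∑' n, a n * b (m - n)) * x ^ m) := fun m => (hrow m).hasSum.mul_right _
    exact hS.prod_fiberwise h

/-- The Taylor coefficients of Euler's product `∏ₙ (1 + q ^ (2 n + 1) x)`. -/
noncomputable def eulerCoeff (q : ℂ) : ℕ → ℂ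
  | 0 => 1
  | k + 1 => q ^ (2 * k + 1) / (1 - q ^ (2 * (k + 1))) * eulerCoeff q k

/-- `eulerCoeff` extended by zero to negative indices. -/
noncomputable def eulerCoeffInt (q : ℂ) : ℤ → ℂ
  | Int.ofNat k => eulerCoeff q k
  | Int.negSucc _ => 0

/-- The power series of Euler's product `∏ₙ (1 + q ^ (2 n + 1) x)`. -/
noncomputable def eulerSeries (q x : ℂ) : ℂ := ∑' k : ℕ, eulerCoeff q k * x ^ k

/-- The theta series `∑ₘ q ^ (m ^ 2) x ^ m`. -/
noncomputable def thetaSeries (q x : ℂ) : ℂ := ∑' m : ℤ, q ^ (m ^ 2) * x ^ m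

section
variable {q : ℂ}

theorem one_sub_pow_ne_zero_of_norm_lt_one (hq1 : ‖q‖ < 1) {n : ℕ} (hn : n ≠ 0) :
    1 - q ^ n ≠ 0 := by
  intro h
  have h1 : ‖q ^ n‖ = 1 := by rw [← sub_eq_zero.1 h, norm_one]
  rw [norm_pow] at h1
  exact (pow_lt_one₀ (norm_nonneg _) hq1 hn).ne h1

theorem eulerCoeff_succ (hq1 : ‖q‖ < 1) (k : ℕ) :
    eulerCoeff q (k + 1) =
      q ^ (2 * (k + 1)) * eulerCoeff q (k + 1) + q ^ (2 * k + 1) * eulerCoeff q k := by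
  have := one_sub_pow_ne_zero_of_norm_lt_one hq1 (n := 2 * (k + 1)) (by omega)
  rw [eulerCoeff]
  field_simp
  ring

theorem eulerCoeff_ne_zero (hq0 : q ≠ 0) (hq1 : ‖q‖ < 1) (k : ℕ) : eulerCoeff q k ≠ 0 := by
  induction k with
  | zero => simp [eulerCoeff]
  | succ k ih =>
    exact mul_ne_zero (div_ne_zero (pow_ne_zero _ hq0)
      (one_sub_pow_ne_zero_of_norm_lt_one hq1 (by omega))) ih

theorem summable_norm_eulerCoeff (hq0 : q ≠ 0) (hq1 : ‖q‖ < 1) (x : ℂ) :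
    Summable fun k : ℕ => ‖eulerCoeff q k * x ^ k‖ := by
  rcases eq_or_ne x 0 with rfl | hx
  · refine summable_of_ne_finset_zero (s := {0}) fun k hk => ?_
    simp at hk
    simp [hk]
  refine summable_of_ratio_test_tendsto_lt_one (l := 0) zero_lt_one
    (Filter.Eventually.of_forall fun k => norm_ne_zero_iff.2
      (mul_ne_zero (eulerCoeff_ne_zero hq0 hq1 k) (pow_ne_zero _ hx))) ?_
  have ht := tendsto_pow_atTop_nhds_zero_of_norm_lt_one hq1
  have h1 : Filter.Tendsto (fun k : ℕ => 2 * k + 1) Filter.atTop Filter.atTop :=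
    Filter.tendsto_atTop_mono (fun k => by dsimp only [id]; omega) Filter.tendsto_id
  have h2 : Filter.Tendsto (fun k : ℕ => 2 * (k + 1)) Filter.atTop Filter.atTop :=
    Filter.tendsto_atTop_mono (fun k => by dsimp only [id]; omega) Filter.tendsto_id
  have h3 : Filter.Tendsto (fun k : ℕ => q ^ (2 * k + 1) / (1 - q ^ (2 * (k + 1))) * x)
      Filter.atTop (nhds 0) := by
    simpa using ((ht.comp h1).div ((ht.comp h2).const_sub 1) (by simp)).mul_const x
  have h4 := h3.norm
  rw [norm_zero] at h4
  refine h4.congr fun k => ?_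
  have := eulerCoeff_ne_zero hq0 hq1 k
  have := pow_ne_zero k hx
  rw [norm_norm, norm_norm, ← norm_div, eulerCoeff, pow_succ]
  congr 1
  field_simp
  ring

theorem eulerSeries_eq_mul (hq0 : q ≠ 0) (hq1 : ‖q‖ < 1) (x : ℂ) :
    eulerSeries q x = (1 + q * x) * eulerSeries q (q ^ 2 * x) := by
  have h0 := (summable_norm_eulerCoeff hq0 hq1 x).of_norm
  have h1 := (summable_norm_eulerCoeff hq0 hq1 (q ^ 2 * x)).of_norm
  have h1' := (summable_nat_add_iff 1).2 h1
  have key : ∀ k : ℕ, eulerCoeff q (k + 1) * x ^ (k + 1) =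
      eulerCoeff q (k + 1) * (q ^ 2 * x) ^ (k + 1) +
        q * x * (eulerCoeff q k * (q ^ 2 * x) ^ k) := by
    intro k
    nth_rw 1 [eulerCoeff_succ hq1 k]
    ring
  rw [add_mul, one_mul]
  conv_lhs => rw [eulerSeries, h0.tsum_eq_zero_add]
  simp_rw [key]
  rw [h1'.tsum_add (h1.mul_left _), tsum_mul_left, ← add_assoc]
  congr 1
  rw [eulerSeries, h1.tsum_eq_zero_add]
  simp

theorem eulerSeries_eq_prod_mul (hq0 : q ≠ 0) (hq1 : ‖q‖ < 1) (x : ℂ) (M : ℕ) :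
    eulerSeries q x =
      (∏ n ∈ range M, (1 + q ^ (2 * n + 1) * x)) * eulerSeries q (q ^ (2 * M) * x) := by
  induction M with
  | zero => simp
  | succ M ih =>
    rw [ih, prod_range_succ, eulerSeries_eq_mul hq0 hq1 (q ^ (2 * M) * x), mul_assoc]
    ring_nf

theorem eulerSeries_eq_zero_iff (hq0 : q ≠ 0) (hq1 : ‖q‖ < 1) (x : ℂ) :
    eulerSeries q x = 0 ↔ ∃ n : ℕ, 1 + q ^ (2 * n + 1) * x = 0 := by
  constructor
  · intro h
    by_contra! hne
    have h0 : ∀ M : ℕ, eulerSeries q (q ^ (2 * M) * x) = 0 := by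
      intro M
      rw [eulerSeries_eq_prod_mul hq0 hq1 x M] at h
      exact (mul_eq_zero.1 h).resolve_left (prod_ne_zero_iff.2 fun n _ => hne n)
    have hlim : Filter.Tendsto (fun M : ℕ => eulerSeries q (q ^ (2 * M) * x)) Filter.atTop
        (nhds (∑' k : ℕ, if k = 0 then (1 : ℂ) else 0)) := by
      refine tendsto_tsum_of_dominated_convergence (summable_norm_eulerCoeff hq0 hq1 x) ?_ ?_
      · intro k
        rcases eq_or_ne k 0 with rfl | hk
        · simp [eulerCoeff]
        · have h2 : Filter.Tendsto (fun M : ℕ => 2 * M) Filter.atTop Filter.atTop :=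
            Filter.tendsto_atTop_mono (fun k => by dsimp only [id]; omega) Filter.tendsto_id
          have := (((tendsto_pow_atTop_nhds_zero_of_norm_lt_one hq1).comp h2).mul_const
            x).pow k |>.const_mul (eulerCoeff q k)
          simpa [hk] using this
      · refine Filter.Eventually.of_forall fun M k => ?_
        rw [norm_mul, norm_mul, norm_pow, norm_pow]
        gcongr
        rw [norm_mul, norm_pow]
        exact mul_le_of_le_one_left (norm_nonneg _) (pow_le_one₀ (norm_nonneg _) hq1.le)
    simp only [h0, tsum_ite_eq] at hlim
    exact zero_ne_one (tendsto_nhds_unique tendsto_const_nhds hlim)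
  · rintro ⟨n, hn⟩
    rw [eulerSeries_eq_prod_mul hq0 hq1 x (n + 1), prod_range_succ, hn]
    simp

@[simp]
theorem eulerCoeffInt_natCast (k : ℕ) : eulerCoeffInt q k = eulerCoeff q k := rfl

theorem eulerCoeffInt_of_neg {k : ℤ} (hk : k < 0) : eulerCoeffInt q k = 0 := by
  cases k with
  | ofNat k => exact absurd hk (by simp)
  | negSucc k => rfl

theorem eulerCoeffInt_eq (hq1 : ‖q‖ < 1) (k : ℤ) :
    eulerCoeffInt q k =
      q ^ (2 * k) * eulerCoeffInt q k + q ^ (2 * k - 1) * eulerCoeffInt q (k - 1) := by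
  rcases lt_trichotomy k 0 with hk | rfl | hk
  · rw [eulerCoeffInt_of_neg hk, eulerCoeffInt_of_neg (by omega : k - 1 < 0)]
    simp
  · rw [eulerCoeffInt_of_neg (by omega : (0 : ℤ) - 1 < 0)]
    simp
  · obtain ⟨n, rfl⟩ : ∃ n : ℕ, k = (n + 1 : ℕ) := ⟨(k - 1).toNat, by omega⟩
    have h1 : ((n + 1 : ℕ) : ℤ) - 1 = (n : ℕ) := by push_cast; ring
    have h2 : 2 * ((n + 1 : ℕ) : ℤ) = (2 * (n + 1) : ℕ) := by push_cast; ring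
    have h3 : ((2 * (n + 1) : ℕ) : ℤ) - 1 = (2 * n + 1 : ℕ) := by push_cast; ring
    rw [h1, h2, h3, zpow_natCast, zpow_natCast]
    exact eulerCoeff_succ hq1 n

theorem range_natCast_of_eulerCoeffInt_ne_zero {k : ℤ} (hk : eulerCoeffInt q k ≠ 0) :
    k ∈ Set.range ((↑) : ℕ → ℤ) := by
  by_contra h
  exact hk (eulerCoeffInt_of_neg (by
    by_contra h0
    exact h ⟨k.toNat, by omega⟩))

theorem summable_norm_eulerCoeffInt (hq0 : q ≠ 0) (hq1 : ‖q‖ < 1) (x : ℂ) :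
    Summable fun k : ℤ => ‖eulerCoeffInt q k * x ^ k‖ := by
  rw [← (Nat.cast_injective (R := ℤ)).summable_iff]
  · exact (summable_norm_eulerCoeff hq0 hq1 x).congr fun k => by simp
  · intro k hk
    rw [norm_eq_zero, mul_eq_zero]
    by_contra! h
    exact hk (range_natCast_of_eulerCoeffInt_ne_zero h.1)

theorem tsum_eulerCoeffInt (x : ℂ) :
    ∑' k : ℤ, eulerCoeffInt q k * x ^ k = eulerSeries q x := by
  rw [← (Nat.cast_injective (R := ℤ)).tsum_eq]
  · simp [eulerSeries]
  · intro k hk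
    exact range_natCast_of_eulerCoeffInt_ne_zero (left_ne_zero_of_mul hk)

/-- A multiple of the Jacobi triple product identity. -/
theorem exists_mul_thetaSeries_eq (hq0 : q ≠ 0) (hq1 : ‖q‖ < 1) :
    ∃ C : ℂ, C ≠ 0 ∧ ∀ x : ℂ, x ≠ 0 →
      (Summable fun m : ℤ => ‖q ^ (m ^ 2) * x ^ m‖) ∧
      C * thetaSeries q x = eulerSeries q x * eulerSeries q x⁻¹ := by
  set a := eulerCoeffInt q with ha
  have hneg : ∀ x : ℂ, (fun m : ℤ => a (-m) * x ^ m) =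
      (fun m : ℤ => a m * x⁻¹ ^ m) ∘ Equiv.neg ℤ := by
    intro x; ext m; simp
  have hb : ∀ x : ℂ, Summable fun m : ℤ => ‖a (-m) * x ^ m‖ := by
    intro x
    refine (((Equiv.neg ℤ).summable_iff).2 (summable_norm_eulerCoeffInt hq0 hq1 x⁻¹)).congr ?_
    intro m; simp [ha]
  have hbt : ∀ x : ℂ, ∑' m : ℤ, a (-m) * x ^ m = eulerSeries q x⁻¹ := by
    intro x
    rw [hneg, ← tsum_eulerCoeffInt]
    exact (Equiv.neg ℤ).tsum_eq (fun m : ℤ => a m * x⁻¹ ^ m)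
  have hsum : ∀ m, Summable fun n : ℤ => a n * a (n - m) := by
    intro m
    simpa using (laurent_mul one_ne_zero (summable_norm_eulerCoeffInt hq0 hq1 1) (hb 1)).1 m
  have hsum' : ∀ m, Summable fun n : ℤ => q ^ (2 * n) * (a n * a (n - m)) := by
    intro m
    have h1 : Summable fun n : ℤ => ‖(a n * q ^ (2 * n)) * 1 ^ n‖ := by
      refine (summable_norm_eulerCoeffInt hq0 hq1 (q ^ 2)).congr fun n => ?_
      rw [one_zpow, mul_one, zpow_mul]
      norm_cast
    refine ((laurent_mul one_ne_zero h1 (hb 1)).1 m).congr fun n => ?_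
    rw [neg_sub]; ring
  set c : ℤ → ℂ := fun m => ∑' n, a n * a (n - m) with hc
  have hrec : ∀ m, c (m + 1) = q ^ (2 * m + 1) * c m := by
    intro m
    have e1 : c (m + 1) = ∑' n, q ^ (2 * n) * (a n * a (n - (m + 1))) +
        ∑' n, q ^ (2 * n + 1) * (a n * a (n - m)) := by
      have hs2 : Summable fun n : ℤ => q ^ (2 * n + 1) * (a n * a (n - m)) := by
        refine ((hsum' m).mul_left q).congr fun n => ?_
        rw [zpow_add_one₀ hq0]; ring
      have hs3 : Summable fun n => q ^ (2 * (n - 1) + 1) * (a (n - 1) * a (n - 1 - m)) :=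
        ((Equiv.subRight (1 : ℤ)).summable_iff).2 hs2
      rw [← (Equiv.subRight (1 : ℤ)).tsum_eq (fun n => q ^ (2 * n + 1) * (a n * a (n - m)))]
      simp only [Equiv.subRight_apply]
      rw [← (hsum' _).tsum_add hs3]
      refine tsum_congr fun n => ?_
      have := eulerCoeffInt_eq hq1 n
      rw [← ha] at this
      nth_rw 1 [this]
      rw [show 2 * (n - 1) + 1 = 2 * n - 1 by ring, show n - 1 - m = n - (m + 1) by ring]
      ring
    have e2 : q ^ (2 * m + 1) * c m = ∑' n, q ^ (2 * n) * (a n * a (n - (m + 1))) +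
        ∑' n, q ^ (2 * n + 1) * (a n * a (n - m)) := by
      have hs2 : Summable fun n : ℤ => q ^ (2 * n + 1) * (a n * a (n - m)) := by
        refine ((hsum' m).mul_left q).congr fun n => ?_
        rw [zpow_add_one₀ hq0]; ring
      rw [← (hsum' _).tsum_add hs2, ← tsum_mul_left]
      refine tsum_congr fun n => ?_
      have := eulerCoeffInt_eq hq1 (n - m)
      rw [← ha] at this
      nth_rw 1 [this]
      rw [show n - m - 1 = n - (m + 1) by ring, show 2 * n = (2 * m + 1) + (2 * (n - m) - 1) by ring,
        show 2 * m + 1 + (2 * (n - m) - 1) + 1 = (2 * m + 1) + 2 * (n - m) by ring,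
        zpow_add₀ hq0 (2 * m + 1), zpow_add₀ hq0 (2 * m + 1)]
      ring
    rw [e1, e2]
  have hcm : ∀ m, c m = c 0 * q ^ (m ^ 2) := by
    intro m
    induction m using Int.induction_on with
    | zero => simp
    | succ n ih =>
      rw [hrec, ih, show ((n : ℤ) + 1) ^ 2 = (2 * n + 1) + n ^ 2 by ring,
        zpow_add₀ hq0 (2 * (n : ℤ) + 1)]
      ring
    | pred n ih =>
      have h := hrec (-n - 1)
      rw [sub_add_cancel, ih] at h
      apply mul_left_cancel₀ (zpow_ne_zero (2 * (-n - 1) + 1 : ℤ) hq0)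
      rw [← h, show (-(n : ℤ)) ^ 2 = (2 * (-n - 1) + 1) + (-n - 1) ^ 2 by ring,
        zpow_add₀ hq0 (2 * (-n - 1) + 1 : ℤ)]
      ring
  have hmain : ∀ x : ℂ, x ≠ 0 → (Summable fun m : ℤ => ‖c 0 * q ^ (m ^ 2) * x ^ m‖) ∧
      c 0 * thetaSeries q x = eulerSeries q x * eulerSeries q x⁻¹ := by
    intro x hx
    obtain ⟨-, h1, h2⟩ := laurent_mul hx (summable_norm_eulerCoeffInt hq0 hq1 x) (hb x)
    rw [tsum_eulerCoeffInt, hbt] at h2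
    have h3 : ∀ m, ∑' n, eulerCoeffInt q n * a (-(m - n)) = c 0 * q ^ (m ^ 2) := by
      intro m
      rw [← hcm]
      simp only [hc, neg_sub, ha]
    simp only [h3] at h1 h2
    refine ⟨h1, ?_⟩
    rw [← h2.tsum_eq, thetaSeries, ← tsum_mul_left]
    simp only [mul_assoc]
  have hc0 : c 0 ≠ 0 := by
    intro h0
    have h1 := (hmain 1 one_ne_zero).2
    rw [h0, zero_mul, inv_one, eq_comm, mul_self_eq_zero, eulerSeries_eq_zero_iff hq0 hq1] at h1
    obtain ⟨n, hn⟩ := h1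
    have h2 : ‖q ^ (2 * n + 1)‖ = 1 := by
      rw [mul_one] at hn
      rw [eq_neg_of_add_eq_zero_right hn, norm_neg, norm_one]
    rw [norm_pow] at h2
    exact (pow_lt_one₀ (norm_nonneg _) hq1 (by omega)).ne h2
  refine ⟨c 0, hc0, fun x hx => ⟨?_, (hmain x hx).2⟩⟩
  refine ((hmain x hx).1.mul_left ‖c 0‖⁻¹).congr fun m => ?_
  have := norm_ne_zero_iff.2 hc0
  simp only [norm_mul]
  field_simp

theorem thetaSeries_eq_zero_iff (hq0 : q ≠ 0) (hq1 : ‖q‖ < 1) {x : ℂ} (hx : x ≠ 0) :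
    thetaSeries q x = 0 ↔ ∃ n : ℤ, x = -q ^ (2 * n + 1) := by
  obtain ⟨C, hC, h⟩ := exists_mul_thetaSeries_eq hq0 hq1
  have h1 := (h x hx).2
  have h2 : thetaSeries q x = 0 ↔ eulerSeries q x = 0 ∨ eulerSeries q x⁻¹ = 0 := by
    rw [← mul_eq_zero, ← h1, mul_eq_zero, or_iff_right hC]
  have h3 : ∀ n : ℕ, 1 + q ^ (2 * n + 1) * x = 0 ↔ x = -q ^ (2 * (-n - 1 : ℤ) + 1) := by
    intro n
    rw [show 2 * (-n - 1 : ℤ) + 1 = -((2 * n + 1 : ℕ) : ℤ) by push_cast; ring, zpow_neg,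
      zpow_natCast]
    have := pow_ne_zero (2 * n + 1) hq0
    rw [add_comm, add_eq_zero_iff_eq_neg, eq_neg_iff_add_eq_zero, eq_neg_iff_add_eq_zero]
    constructor <;> intro h
    · field_simp; linear_combination h
    · field_simp at h; linear_combination h
  have h4 : ∀ n : ℕ, 1 + q ^ (2 * n + 1) * x⁻¹ = 0 ↔ x = -q ^ (2 * (n : ℤ) + 1) := by
    intro n
    rw [show 2 * (n : ℤ) + 1 = ((2 * n + 1 : ℕ) : ℤ) by push_cast; ring, zpow_natCast,
      eq_neg_iff_add_eq_zero]
    constructor <;> intro h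
    · field_simp at h; linear_combination h
    · field_simp; linear_combination h
  rw [h2, eulerSeries_eq_zero_iff hq0 hq1, eulerSeries_eq_zero_iff hq0 hq1]
  simp only [h3, h4]
  constructor
  · rintro (⟨n, hn⟩ | ⟨n, hn⟩)
    · exact ⟨_, hn⟩
    · exact ⟨_, hn⟩
  · rintro ⟨n, hn⟩
    rcases le_or_gt 0 n with h0 | h0
    · exact Or.inr ⟨n.toNat, by rwa [Int.toNat_of_nonneg h0]⟩
    · exact Or.inl ⟨(-n - 1).toNat, by
        rw [Int.toNat_of_nonneg (by omega)]; convert hn using 4; ring⟩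

/-- `F` is given on `ℂ \ {0}` by a Laurent series `∑ₘ c m x ^ m` whose coefficients satisfy the
quasi-periodicity `c (m + d) = q ^ (2 m + d) B c m`, i.e. `F` is a theta function of degree `d`. -/
def HasThetaExpansion (q : ℂ) (d : ℤ) (B : ℂ) (F : ℂ → ℂ) : Prop :=
  ∃ c : ℤ → ℂ, (∀ m, c (m + d) = q ^ (2 * m + d) * B * c m) ∧
    ∀ x : ℂ, x ≠ 0 → (Summable fun m => ‖c m * x ^ m‖) ∧ HasSum (fun m => c m * x ^ m) (F x)

theorem HasThetaExpansion.mul {d d' : ℤ} {B B' : ℂ} {F G : ℂ → ℂ} (hq0 : q ≠ 0)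
    (hF : HasThetaExpansion q d B F) (hG : HasThetaExpansion q d' B' G) :
    HasThetaExpansion q (d + d') (B * B') (fun x => F x * G x) := by
  obtain ⟨a, ha, ha'⟩ := hF
  obtain ⟨b, hb, hb'⟩ := hG
  refine ⟨fun m => ∑' n, a n * b (m - n), fun m => ?_, fun x hx => ?_⟩
  · dsimp only
    rw [← (Equiv.addRight d).tsum_eq, ← tsum_mul_left]
    refine tsum_congr fun n => ?_
    simp only [Equiv.coe_addRight]
    rw [ha, show m + (d + d') - (n + d) = (m - n) + d' by ring, hb,
      show 2 * m + (d + d') = (2 * n + d) + (2 * (m - n) + d') by ring, zpow_add₀ hq0 (2 * n + d)]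
    ring
  · have h := laurent_mul hx (ha' x hx).1 (hb' x hx).1
    rw [(ha' x hx).2.tsum_eq, (hb' x hx).2.tsum_eq] at h
    exact h.2

theorem hasThetaExpansion_zpow (hq0 : q ≠ 0) (r : ℤ) :
    HasThetaExpansion q 0 (q ^ (-2 * r)) (fun x => x ^ r) := by
  refine ⟨fun m => if m = r then 1 else 0, fun m => ?_, fun x hx => ⟨?_, ?_⟩⟩
  · by_cases h : m = r
    · have := zpow_ne_zero (2 * r) hq0
      simp [h, this]
    · simp [h]
  · refine summable_of_ne_finset_zero (s := {r}) fun m hm => ?_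
    simp at hm
    simp [hm]
  · convert hasSum_ite_eq r (x ^ r) using 2 with m
    split_ifs with h <;> simp [h]

theorem hasThetaExpansion_thetaSeries (hq0 : q ≠ 0) (hq1 : ‖q‖ < 1) {b : ℂ} (hb : b ≠ 0) :
    HasThetaExpansion q 1 b (fun x => thetaSeries q (b * x)) := by
  obtain ⟨_, _, h⟩ := exists_mul_thetaSeries_eq hq0 hq1
  refine ⟨fun m => q ^ (m ^ 2) * b ^ m, fun m => ?_, fun x hx => ?_⟩
  · dsimp only
    rw [show (m + 1) ^ 2 = (2 * m + 1) + m ^ 2 by ring, zpow_add₀ hq0 (2 * m + 1),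
      zpow_add_one₀ hb]
    ring
  · have h1 := (h (b * x) (mul_ne_zero hb hx)).1
    have h2 := h1.of_norm.hasSum
    simp only [mul_zpow, ← mul_assoc] at h1 h2
    refine ⟨h1, ?_⟩
    simpa only [thetaSeries, mul_zpow, ← mul_assoc] using h2

theorem hasThetaExpansion_prod {ι : Type*} (hq0 : q ≠ 0) (hq1 : ‖q‖ < 1) (s : Finset ι)
    {b : ι → ℂ} (hb : ∀ i, b i ≠ 0) :
    HasThetaExpansion q s.card (∏ i ∈ s, b i) (fun x => ∏ i ∈ s, thetaSeries q (b i * x)) := by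
  classical
  induction s using Finset.induction_on with
  | empty => simpa using hasThetaExpansion_zpow hq0 0
  | insert i s hi ih =>
    simp only [prod_insert hi, card_insert_of_notMem hi]
    rw [Nat.cast_succ, add_comm (s.card : ℤ)]
    exact (hasThetaExpansion_thetaSeries hq0 hq1 (hb i)).mul hq0 ih

/-- A theta function of even degree with prescribed zeros whose product is an even power
of `q`. -/
theorem exists_thetaExpansion_of_prod_eq {ι : Type*} [Fintype ι] (hq0 : q ≠ 0) (hq1 : ‖q‖ < 1)
    (hι : Even (Fintype.card ι)) {y : ι → ℂ} (hy : ∀ i, y i ≠ 0) {u : ℤ}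
    (hu : ∏ i, y i = q ^ (2 * u)) :
    ∃ F : ℂ → ℂ, HasThetaExpansion q (Fintype.card ι) 1 F ∧
      ∀ x, x ≠ 0 → (F x = 0 ↔ ∃ i, ∃ n : ℤ, x = y i * q ^ (2 * n)) := by
  obtain ⟨M, hM⟩ := hι
  have hb : ∀ i, -q / y i ≠ 0 := fun i => div_ne_zero (neg_ne_zero.2 hq0) (hy i)
  have h1 := (hasThetaExpansion_zpow hq0 (M - u)).mul hq0
    (hasThetaExpansion_prod hq0 hq1 univ hb)
  refine ⟨fun x => x ^ (M - u) * ∏ i, thetaSeries q (-q / y i * x), ?_, fun x hx => ?_⟩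
  rotate_left
  · rw [mul_eq_zero, or_iff_right (zpow_ne_zero _ hx), prod_eq_zero_iff]
    simp only [mem_univ, true_and]
    refine exists_congr fun i => ?_
    rw [thetaSeries_eq_zero_iff hq0 hq1 (mul_ne_zero (hb i) hx)]
    refine exists_congr fun n => ?_
    have := hy i
    rw [zpow_add_one₀ hq0]
    constructor <;> intro h
    · field_simp at h
      linear_combination -h
    · rw [h]; field_simp
  · convert h1 using 1
    · simp
    · rw [prod_div_distrib, hu, prod_const, card_univ, hM, Even.neg_pow ⟨M, rfl⟩, ← zpow_natCast,
        ← zpow_sub₀ hq0, ← zpow_add₀ hq0]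
      push_cast
      ring_nf
      simp

end

section
variable {N : ℕ} {lam : ℝ}

/-- The nome of the theta functions attached to the Gaussian of parameter `lam` on `ℂ^N`. -/
noncomputable def gaussianNome (N : ℕ) (lam : ℝ) : ℂ := cexp (-(Real.pi * lam / N))

/-- The image under the exponential map of the torsion point of the torus `ℂ^× / q ^ (2 ℤ)` with
coordinates `a / N` and `b / N`. -/
noncomputable def torsionPoint (N : ℕ) (lam : ℝ) (a b : ℤ) : ℂ :=
  cexp (2 * Real.pi * lam * a / N ^ 2 + 2 * Real.pi * I * b / N)

theorem gaussianNome_ne_zero : gaussianNome N lam ≠ 0 := exp_ne_zero _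

theorem gaussianNome_zpow (n : ℤ) :
    gaussianNome N lam ^ n = cexp (n * -(Real.pi * lam / N)) := by
  rw [gaussianNome, Complex.exp_int_mul]

theorem torsionPoint_add (a b a' b' : ℤ) :
    torsionPoint N lam (a + a') (b + b') = torsionPoint N lam a b * torsionPoint N lam a' b' := by
  rw [torsionPoint, torsionPoint, torsionPoint, ← Complex.exp_add]
  push_cast
  ring_nf

theorem torsionPoint_sub (a b a' b' : ℤ) :
    torsionPoint N lam (a - a') (b - b') = torsionPoint N lam a b / torsionPoint N lam a' b' := by
  rw [torsionPoint, torsionPoint, torsionPoint, ← Complex.exp_sub]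
  push_cast
  ring_nf

theorem prod_torsionPoint {ι : Type*} (s : Finset ι) (a b : ι → ℤ) :
    ∏ i ∈ s, torsionPoint N lam (a i) (b i) =
      torsionPoint N lam (∑ i ∈ s, a i) (∑ i ∈ s, b i) := by
  classical
  induction s using Finset.induction_on with
  | empty => simp [torsionPoint]
  | insert i s hi ih => rw [prod_insert hi, sum_insert hi, sum_insert hi, torsionPoint_add, ih]

theorem thetaCoeff_add_mul {c : ℤ → ℂ} {q : ℂ} (hq0 : q ≠ 0)
    (hc : ∀ m, c (m + N) = q ^ (2 * m + N) * c m) (m j : ℤ) :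
    c (m + N * j) = q ^ (2 * m * j + N * j ^ 2) * c m := by
  induction j using Int.induction_on with
  | zero => simp
  | succ n ih =>
    rw [show m + N * ((n : ℤ) + 1) = (m + N * n) + N by ring, hc, ih, ← mul_assoc,
      ← zpow_add₀ hq0]
    ring_nf
  | pred n ih =>
    have h := hc (m + N * (-n - 1))
    rw [show m + N * (-(n : ℤ) - 1) + N = m + N * -n by ring, ih] at h
    apply mul_left_cancel₀ (zpow_ne_zero (2 * (m + N * (-n - 1)) + N : ℤ) hq0)
    rw [← h, ← mul_assoc, ← zpow_add₀ hq0]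
    ring_nf

variable [NeZero N]

theorem norm_gaussianNome_lt_one (hlam : 0 < lam) : ‖gaussianNome N lam‖ < 1 := by
  have hN : (0 : ℝ) < N := Nat.cast_pos.2 (NeZero.pos N)
  have h : -((Real.pi : ℂ) * lam / N) = ((-(Real.pi * lam / N) : ℝ) : ℂ) := by push_cast; rfl
  rw [gaussianNome, h, norm_exp_ofReal, Real.exp_lt_one_iff]
  have := Real.pi_pos
  have : 0 < Real.pi * lam / N := by positivity
  linarith

theorem torsionPoint_eq_zpow_iff (hlam : 0 < lam) (a b n : ℤ) :
    torsionPoint N lam a b = gaussianNome N lam ^ (2 * n) ↔ a = -(N * n) ∧ (N : ℤ) ∣ b := by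
  have hN : (N : ℝ) ≠ 0 := Nat.cast_ne_zero.2 (NeZero.ne N)
  have hN' : (N : ℂ) ≠ 0 := Nat.cast_ne_zero.2 (NeZero.ne N)
  have hpi := Real.pi_ne_zero
  have hl := hlam.ne'
  rw [gaussianNome_zpow, torsionPoint, Complex.exp_eq_exp_iff_exists_int]
  constructor
  · rintro ⟨m, hm⟩
    have h : (2 * Real.pi * lam * a / N ^ 2 + 2 * Real.pi * I * b / N : ℂ) =
        ((2 * Real.pi * lam * a / N ^ 2 : ℝ) : ℂ) + ((2 * Real.pi * b / N : ℝ) : ℂ) * I := by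
      push_cast; ring
    have h' : (((2 * n : ℤ) : ℂ) * -(Real.pi * lam / N) + m * (2 * Real.pi * I) : ℂ) =
        ((-(2 * n * (Real.pi * lam / N)) : ℝ) : ℂ) + ((2 * Real.pi * m : ℝ) : ℂ) * I := by
      push_cast; ring
    rw [h, h'] at hm
    have hre := congrArg Complex.re hm
    have him := congrArg Complex.im hm
    simp only [add_re, add_im, re_ofReal_mul, im_ofReal_mul, ofReal_re, ofReal_im, I_re, I_im,
      mul_zero, mul_one, add_zero, zero_add] at hre him
    field_simp at hre him
    refine ⟨?_, m, ?_⟩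
    · have : (a : ℝ) = ((-(N * n) : ℤ) : ℝ) := by push_cast; linear_combination hre
      exact_mod_cast this
    · have : (b : ℝ) = ((N * m : ℤ) : ℝ) := by push_cast; linear_combination him
      exact_mod_cast this
  · rintro ⟨rfl, m, rfl⟩
    refine ⟨m, ?_⟩
    push_cast
    field_simp

theorem zmod_val_eq_of_dvd {a b : ZMod N} (h : (N : ℤ) ∣ (a.val : ℤ) - b.val) : a = b := by
  have := (ZMod.intCast_zmod_eq_zero_iff_dvd _ N).2 h
  simpa [sub_eq_zero] using this

theorem torsionPoint_eq_mul_zpow (hlam : 0 < lam) {k l k' l' : ZMod N} {n : ℤ}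
    (h : torsionPoint N lam k.val l.val =
      torsionPoint N lam k'.val l'.val * gaussianNome N lam ^ (2 * n)) : k = k' ∧ l = l' := by
  have h0 : torsionPoint N lam k'.val l'.val ≠ 0 := exp_ne_zero _
  have h1 : torsionPoint N lam (k.val - k'.val) (l.val - l'.val) =
      gaussianNome N lam ^ (2 * n) := by
    rw [torsionPoint_sub, h, mul_div_cancel_left₀ _ h0]
  obtain ⟨h2, h3⟩ := (torsionPoint_eq_zpow_iff hlam _ _ _).1 h1
  exact ⟨zmod_val_eq_of_dvd ⟨-n, by rw [h2]; ring⟩, zmod_val_eq_of_dvd h3⟩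

/-- Representing integers by a residue and a multiple of `N`. -/
noncomputable def zmodProdIntEquiv (N : ℕ) [NeZero N] : ZMod N × ℤ ≃ ℤ :=
  Equiv.ofBijective (fun p => p.1.val + N * p.2) <| by
    have hN : (N : ℤ) ≠ 0 := Nat.cast_ne_zero.2 (NeZero.ne N)
    constructor
    · rintro ⟨m, j⟩ ⟨m', j'⟩ h
      simp only at h
      obtain rfl : m = m' := zmod_val_eq_of_dvd ⟨j' - j, by linear_combination h⟩
      have : (N : ℤ) * j = N * j' := by linear_combination h
      rw [mul_left_cancel₀ hN this]
    · intro n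
      obtain ⟨j, hj⟩ : (N : ℤ) ∣ n - ((n : ZMod N).val : ℤ) :=
        (ZMod.intCast_zmod_eq_zero_iff_dvd _ N).1 (by simp)
      exact ⟨(n, j), by simp only; linear_combination -hj⟩

theorem zmodProdIntEquiv_apply (m : ZMod N) (j : ℤ) :
    zmodProdIntEquiv N (m, j) = m.val + N * j := rfl

theorem periodizedGaussian_sub (m k : ZMod N) :
    periodizedGaussian N lam (m - k) =
      ∑' j : ℤ, cexp (-Real.pi * lam * (((m.val : ℂ) - k.val) / N + j) ^ 2) := by
  have hN' : (N : ℂ) ≠ 0 := Nat.cast_ne_zero.2 (NeZero.ne N)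
  obtain ⟨t, ht⟩ : (N : ℤ) ∣ ((m - k).val : ℤ) - (m.val - k.val) :=
    (ZMod.intCast_zmod_eq_zero_iff_dvd _ N).1 (by simp)
  have ht' : ((m - k).val : ℂ) = m.val - k.val + N * t := by
    have := congrArg (Int.cast : ℤ → ℂ) ht
    push_cast at this
    linear_combination this
  rw [periodizedGaussian, Complex.ofReal_tsum, ← (Equiv.subLeft t).tsum_eq]
  refine tsum_congr fun j => ?_
  push_cast
  rw [ht', Equiv.subLeft_apply]
  congr 2
  push_cast
  field_simp
  ring

theorem gaussian_mul_torsionPoint_zpow {c : ℤ → ℂ}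
    (hc : ∀ m, c (m + N) = gaussianNome N lam ^ (2 * m + N) * c m) (m k l j : ℤ) :
    c m * cexp (Real.pi * lam * m ^ 2 / N ^ 2) * (cexp (2 * Real.pi * I * l * m / N) *
        cexp (-Real.pi * lam * (((m : ℂ) - k) / N + j) ^ 2)) =
      cexp (-(Real.pi * lam * k ^ 2 / N ^ 2)) *
        (c (m + N * j) * torsionPoint N lam k l ^ (m + N * j)) := by
  have hN' : (N : ℂ) ≠ 0 := Nat.cast_ne_zero.2 (NeZero.ne N)
  have hroot : cexp (2 * Real.pi * I * l * j) = 1 :=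
    Complex.exp_eq_one_iff.2 ⟨l * j, by push_cast; ring⟩
  rw [thetaCoeff_add_mul gaussianNome_ne_zero hc, gaussianNome_zpow, torsionPoint,
    ← Complex.exp_int_mul]
  have key : ∀ A B C D E G : ℂ, A + B + C + 2 * Real.pi * I * l * j = D + E + G →
      c m * cexp A * (cexp B * cexp C) = cexp D * (cexp E * c m * cexp G) := by
    intro A B C D E G h
    have h1 : cexp A * cexp B * cexp C = cexp D * cexp E * cexp G := by
      rw [← mul_one (cexp A * cexp B * cexp C), ← hroot, ← Complex.exp_add, ← Complex.exp_add,
        ← Complex.exp_add, ← Complex.exp_add, ← Complex.exp_add, h]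
    linear_combination c m * h1
  apply key
  push_cast
  field_simp
  ring

/-- Theta functions of degree `N` are the short-time Fourier transforms with Gaussian window. -/
theorem exists_sum_mul_tfShift {F : ℂ → ℂ}
    (hF : HasThetaExpansion (gaussianNome N lam) N 1 F) :
    ∃ f : ZMod N → ℂ, ∀ k l : ZMod N,
      ∑ m, f m * tfShift k l (periodizedGaussian N lam) m =
        cexp (-(Real.pi * lam * k.val ^ 2 / N ^ 2)) * F (torsionPoint N lam k.val l.val) := by
  obtain ⟨c, hc, hc'⟩ := hF
  simp only [mul_one] at hc
  refine ⟨fun m => c m.val * cexp (Real.pi * lam * m.val ^ 2 / N ^ 2), fun k l => ?_⟩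
  have hs := ((hc' (torsionPoint N lam k.val l.val) (exp_ne_zero _)).2.mul_left
    (cexp (-(Real.pi * lam * k.val ^ 2 / N ^ 2))))
  have hs' := (zmodProdIntEquiv N).hasSum_iff.2 hs
  rw [← hs'.tsum_eq, hs'.summable.tsum_prod, tsum_fintype]
  refine sum_congr rfl fun m _ => ?_
  rw [tfShift, periodizedGaussian_sub, ← tsum_mul_left, ← tsum_mul_left]
  exact tsum_congr fun j => by
    simpa [zmodProdIntEquiv_apply] using gaussian_mul_torsionPoint_zpow hc m.val k.val l.val j

/-- There is a vector whose bilinear pairings with the shifted Gaussians vanish exactly at the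
torsion points congruent to one of the prescribed zeros. -/
theorem exists_sum_mul_tfShift_eq_zero_iff (hNe : Even N) (hlam : 0 < lam) {y : Fin N → ℂ}
    (hy : ∀ i, y i ≠ 0) {u : ℤ} (hu : ∏ i, y i = gaussianNome N lam ^ (2 * u)) :
    ∃ f : ZMod N → ℂ, ∀ k l : ZMod N,
      ∑ m, f m * tfShift k l (periodizedGaussian N lam) m = 0 ↔
        ∃ i, ∃ n : ℤ, torsionPoint N lam k.val l.val = y i * gaussianNome N lam ^ (2 * n) := by
  obtain ⟨F, hF, hF0⟩ := exists_thetaExpansion_of_prod_eq gaussianNome_ne_zero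
    (norm_gaussianNome_lt_one hlam) (by simpa using hNe) hy hu
  rw [Fintype.card_fin] at hF
  obtain ⟨f, hf⟩ := exists_sum_mul_tfShift hF
  refine ⟨f, fun k l => ?_⟩
  rw [hf, mul_eq_zero, or_iff_right (exp_ne_zero _)]
  exact hF0 _ (exp_ne_zero _)

end

theorem even_N_periodized_gaussian_basis_iff (N : ℕ) [NeZero N] (hN : 2 ≤ N)
    (hNe : Even N) (lam : ℝ) (hlam : 0 < lam)
    (p : Fin N → ZMod N × ZMod N) (hp : Function.Injective p) :
    LinearIndependent ℂ
        (fun k : Fin N => tfShift (p k).1 (p k).2 (periodizedGaussian N lam)) ↔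
      ¬ (N ∣ ∑ k : Fin N, ((p k).1).val ∧ N ∣ ∑ k : Fin N, ((p k).2).val) := by
  set x : Fin N → ℂ := fun i => torsionPoint N lam (p i).1.val (p i).2.val with hx
  have hx0 : ∀ i, x i ≠ 0 := fun i => exp_ne_zero _
  have hprod : ∏ i, x i = torsionPoint N lam (∑ i, ((p i).1.val : ℤ)) (∑ i, ((p i).2.val : ℤ)) :=
    prod_torsionPoint _ _ _
  constructor
  · rintro hli ⟨⟨t, ht⟩, hdvd⟩
    have hu : ∏ i, x i = gaussianNome N lam ^ (2 * (-t : ℤ)) := by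
      rw [hprod, torsionPoint_eq_zpow_iff hlam]
      exact ⟨by rw [mul_neg, neg_neg]; exact_mod_cast ht, by exact_mod_cast hdvd⟩
    obtain ⟨f, hf⟩ := exists_sum_mul_tfShift_eq_zero_iff hNe hlam hx0 hu
    obtain ⟨⟨k, l⟩, hkl⟩ : ∃ r, r ∉ Set.range p := by
      by_contra! h
      have hcard := Fintype.card_le_of_surjective p h
      simp only [Fintype.card_prod, ZMod.card, Fintype.card_fin] at hcard
      nlinarith
    let φ : (ZMod N → ℂ) →ₗ[ℂ] ℂ := Fintype.linearCombination ℂ f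
    have hφ : ∀ v, φ v = ∑ m, f m * v m := fun v => by
      simp [φ, Fintype.linearCombination_apply, mul_comm]
    have hspan := hli.span_eq_top_of_card_eq_finrank (by simp)
    have hφ0 : φ = 0 := by
      refine LinearMap.ext_on_range hspan fun i => ?_
      rw [hφ, LinearMap.zero_apply, hf]
      exact ⟨i, 0, by simp [hx]⟩
    obtain ⟨i, n, hin⟩ := (hf k l).1 (by rw [← hφ, hφ0, LinearMap.zero_apply])
    obtain ⟨h1, h2⟩ := torsionPoint_eq_mul_zpow hlam hin
    exact hkl ⟨i, by rw [h1, h2]⟩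
  · intro hndvd
    rw [Fintype.linearIndependent_iff]
    intro g hg k
    have hy0 : ∀ i, Function.update x k (∏ j ∈ univ.erase k, x j)⁻¹ i ≠ 0 := by
      intro i
      rcases eq_or_ne i k with rfl | hi
      · simpa using inv_ne_zero (prod_ne_zero_iff.2 fun j _ => hx0 j)
      · simpa [hi] using hx0 i
    have hu : ∏ i, Function.update x k (∏ j ∈ univ.erase k, x j)⁻¹ i =
        gaussianNome N lam ^ (2 * (0 : ℤ)) := by
      rw [prod_update_of_mem (mem_univ k), mul_zero, zpow_zero, sdiff_singleton_eq_erase]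
      exact inv_mul_cancel₀ (prod_ne_zero_iff.2 fun j _ => hx0 j)
    obtain ⟨f, hf⟩ := exists_sum_mul_tfShift_eq_zero_iff hNe hlam hy0 hu
    have hk : ∑ m, f m * tfShift (p k).1 (p k).2 (periodizedGaussian N lam) m ≠ 0 := by
      rw [Ne, hf]
      rintro ⟨i, n, hin⟩
      rcases eq_or_ne i k with rfl | hi
      · refine hndvd ?_
        have h1 : ∏ j, x j = gaussianNome N lam ^ (2 * n) := by
          rw [← mul_prod_erase univ x (mem_univ i)]
          change x i = _ at hin
          rw [Function.update_self] at hin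
          rw [hin]
          have : ∏ j ∈ univ.erase i, x j ≠ 0 := prod_ne_zero_iff.2 fun j _ => hx0 j
          field_simp
        rw [hprod, torsionPoint_eq_zpow_iff hlam] at h1
        have h2 : (N : ℤ) ∣ ∑ i, ((p i).1.val : ℤ) := ⟨-n, by rw [h1.1]; ring⟩
        exact ⟨by exact_mod_cast h2, by exact_mod_cast h1.2⟩
      · rw [Function.update_of_ne hi] at hin
        obtain ⟨h1, h2⟩ := torsionPoint_eq_mul_zpow hlam hin
        exact hi (hp (Prod.ext h1 h2)).symm
    have hsum : ∑ i, g i * ∑ m, f m * tfShift (p i).1 (p i).2 (periodizedGaussian N lam) m = 0 := by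
      have h1 : ∀ m, ∑ i, g i * tfShift (p i).1 (p i).2 (periodizedGaussian N lam) m = 0 :=
        fun m => by simpa using congrFun hg m
      calc _ = ∑ m, f m * ∑ i, g i * tfShift (p i).1 (p i).2 (periodizedGaussian N lam) m := by
            simp only [mul_sum]
            rw [sum_comm]
            exact sum_congr rfl fun m _ => sum_congr rfl fun i _ => by ring
        _ = 0 := by simp [h1]
    rw [sum_eq_single k] at hsum
    · exact (mul_eq_zero.1 hsum).resolve_right hk
    · intro i _ hi
      rw [(hf _ _).2 ⟨i, 0, by simp [hi, hx]⟩, mul_zero]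
    · simp
end
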